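/- The twistor map q : ℂP⁵ → ℍP² admits no continuous global section; that is, there is no continuous map s : ℍP² → ℂP⁵ with q ∘ s equal to the identity of ℍP². -/

import Mathlib

noncomputable section

open Quaternion

/-- The standard inclusion of `ℂ` into the quaternions `ℍ`. -/
def cq (z : ℂ) : ℍ[ℝ] := ⟨z.re, z.im, 0, 0⟩

lemma cq_ne_zero {z : ℂ} (hz : z ≠ 0) : cq z ≠ 0 := by
  intro h
  apply hz
  have h1 : (cq z).re = 0 := by rw [h]; rfl
  have h2 : (cq z).imI = 0 := by rw [h]; rfl
  exact Complex.ext h1 h2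

/-- Nonzero vectors of `ℍ³`. -/
abbrev V3x : Type := {v : Fin 3 → ℍ[ℝ] // v ≠ 0}

/-- Two nonzero vectors of `ℍ³` span the same complex line. -/
def crel (v w : V3x) : Prop := ∃ c : ℂ, c ≠ 0 ∧ w.1 = fun i => v.1 i * cq c

/-- Two nonzero vectors of `ℍ³` span the same quaternionic line. -/
def hrel (v w : V3x) : Prop := ∃ a : ℍ[ℝ], a ≠ 0 ∧ w.1 = fun i => v.1 i * a

/-- `ℂP⁵`, the space of complex lines in `ℍ³ ≅ ℂ⁶`, with the quotient topology. -/
def CP5 : Type := Quot crel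

/-- `ℍP²`, the space of quaternionic lines in `ℍ³`, with the quotient topology. -/
def HP2 : Type := Quot hrel

instance : TopologicalSpace CP5 := instTopologicalSpaceQuot
instance : TopologicalSpace HP2 := instTopologicalSpaceQuot

/-- The twistor map `ℂP⁵ → ℍP²`, sending the complex line spanned by `v` to the
quaternionic line spanned by `v`. -/
def twistor : CP5 → HP2 :=
  Quot.lift (fun v => Quot.mk hrel v)
    (fun _ _ ⟨c, hc, hw⟩ => Quot.sound ⟨cq c, cq_ne_zero hc, hw⟩)

/-- A polynomial identity: the determinant of `1 + H` is a fixed affine combination of the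
determinants of `1 + t i • H`. -/
lemma exists_det_one_add_eq_sum {E : Type*} [NormedAddCommGroup E] [NormedSpace ℝ E]
    [FiniteDimensional ℝ E] {t : ℕ → ℝ} (ht : Function.Injective t) :
    ∃ c : ℕ → ℝ, ∀ H : E →L[ℝ] E, (1 + H).det =
      ∑ i ∈ Finset.range (Module.finrank ℝ E + 1), c i * (1 + t i • H).det := by
  classical
  let b := Module.finBasis ℝ E
  set s := Finset.range (Module.finrank ℝ E + 1) with hs
  refine ⟨fun i => (Lagrange.basis s t i).eval 1, fun H => ?_⟩
  let M := LinearMap.toMatrix b b (H : E →ₗ[ℝ] E)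
  let p : Polynomial ℝ := Matrix.det ((Polynomial.X : Polynomial ℝ) • M.map Polynomial.C +
    (1 : Matrix _ _ ℝ).map Polynomial.C)
  have hp : ∀ a : ℝ, p.eval a = (1 + a • H).det := by
    intro a
    have h1 : (1 + a • H).det = Matrix.det (1 + a • M) := by
      rw [ContinuousLinearMap.det, ← LinearMap.det_toMatrix b]
      congr 1
      simp [M, ContinuousLinearMap.toLinearMap_add, ContinuousLinearMap.one_def]
    rw [h1, ← Polynomial.coe_evalRingHom, RingHom.map_det]
    congr 1
    ext i j
    by_cases hij : i = j <;> simp [hij, add_comm] <;> ring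
  have hdeg : p.degree < s.card := by
    refine lt_of_le_of_lt Polynomial.degree_le_natDegree ?_
    have := Polynomial.natDegree_det_X_add_C_le M 1
    simp only [Fintype.card_fin] at this
    simp only [hs, Finset.card_range]
    exact_mod_cast Nat.lt_succ_of_le this
  have h := Lagrange.eq_interpolate (s := s) (v := t) ht.injOn hdeg
  have h2 := congrArg (Polynomial.eval 1) h
  rw [hp, one_smul, Lagrange.interpolate_apply, Polynomial.eval_finsetSum] at h2
  rw [h2]
  refine Finset.sum_congr rfl fun i _ => ?_
  rw [Polynomial.eval_mul, Polynomial.eval_C, hp, mul_comm]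

lemma not_contDiff_retraction {E : Type*} [NormedAddCommGroup E] [InnerProductSpace ℝ E]
    [FiniteDimensional ℝ E] {r : E → E} {R : ℝ} (hR : 0 < R)
    (hr : ContDiff ℝ 1 r) (hnorm : ∀ x, ‖r x‖ = R) (hid : ∀ x, ‖x‖ = R → r x = x) : False := by
  borelize E
  let μ : MeasureTheory.Measure E := MeasureTheory.Measure.addHaar
  let H : E → E →L[ℝ] E := fun x => fderiv ℝ r x - 1
  let f : ℝ → E → E := fun t x => x + t • (r x - x)
  have hHc : Continuous H := (hr.continuous_fderiv one_ne_zero).sub continuous_const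
  have hk : ∀ x, HasFDerivAt (fun y => r y - y) (H x) x := fun x =>
    ((hr.differentiable one_ne_zero) x).hasFDerivAt.sub (hasFDerivAt_id x)
  have hf : ∀ t x, HasFDerivAt (f t) (1 + t • H x) x := fun t x =>
    (hasFDerivAt_id x).add ((hk x).const_smul t)
  have hdetc : Continuous fun A : E →L[ℝ] E => A.det := ContinuousLinearMap.continuous_det
  -- determinant vanishes at time one
  have hdet1 : ∀ x, (1 + H x).det = 0 := by
    intro x
    by_contra hne
    have hHx : 1 + H x = fderiv ℝ r x := by simp [H]
    rw [hHx] at hne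
    let e := LinearEquiv.ofIsUnitDet (f := (fderiv ℝ r x : E →ₗ[ℝ] E)) (v := Module.finBasis ℝ E)
      (v' := Module.finBasis ℝ E) (by
        rw [LinearMap.det_toMatrix]; exact isUnit_iff_ne_zero.mpr hne)
    obtain ⟨v, hv⟩ := e.surjective (r x)
    have hv' : fderiv ℝ r x v = r x := hv
    have hd := ((hr.differentiable one_ne_zero) x).hasFDerivAt
    have h1 := hd.inner ℝ hd
    have h2 : HasFDerivAt (fun y => inner ℝ (r y) (r y)) (0 : E →L[ℝ] ℝ) x := by
      have : (fun y => inner ℝ (r y) (r y)) = fun _ => R ^ 2 := by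
        funext y; rw [real_inner_self_eq_norm_sq, hnorm]
      rw [this]; exact hasFDerivAt_const _ _
    have h3 := congrArg (fun A : E →L[ℝ] ℝ => A v) (h1.unique h2)
    simp [hv', hnorm] at h3
    exact hR.ne' h3
  -- positivity of the determinant for small times
  have hpos : ∀ᶠ t in nhds (0 : ℝ), ∀ x ∈ Metric.closedBall (0 : E) R, 0 < (1 + t • H x).det := by
    refine (isCompact_closedBall (0 : E) R).eventually_forall_of_forall_eventually fun x _ => ?_
    have hc : Continuous fun p : ℝ × E => (1 + p.1 • H p.2).det :=
      hdetc.comp (continuous_const.add (continuous_fst.smul (hHc.comp continuous_snd)))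
    refine hc.continuousAt.eventually (lt_mem_nhds ?_)
    simp [ContinuousLinearMap.det, ContinuousLinearMap.one_def]
  obtain ⟨K, hK⟩ : ∃ K : NNReal, ∀ x ∈ Metric.closedBall (0 : E) R, ‖H x‖₊ ≤ K := by
    obtain ⟨C, hC⟩ := (isCompact_closedBall (0 : E) R).exists_bound_of_continuousOn hHc.continuousOn
    exact ⟨C.toNNReal, fun x hx => by
      rw [← NNReal.coe_le_coe]; exact (hC x hx).trans (Real.le_coe_toNNReal C)⟩
  have hLip : LipschitzOnWith K (fun y => r y - y) (Metric.closedBall (0 : E) R) :=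
    (convex_closedBall (0 : E) R).lipschitzOnWith_of_nnnorm_fderiv_le
      (fun x _ => (hk x).differentiableAt) fun x hx => by rw [(hk x).fderiv]; exact hK x hx
  -- the integral is constant for small times
  have key : ∀ t : ℝ, 0 < t → t < 1 → t * K < 1 →
      (∀ x ∈ Metric.closedBall (0 : E) R, 0 < (1 + t • H x).det) →
      ∫ x in Metric.ball (0 : E) R, (1 + t • H x).det ∂μ = μ.real (Metric.ball (0 : E) R) := by
    intro t ht0 ht1 htK hdet
    have hinj : Set.InjOn (f t) (Metric.ball (0 : E) R) := by
      intro x hx y hy hxy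
      have h1 := hLip.dist_le_mul x (Metric.ball_subset_closedBall hx) y
        (Metric.ball_subset_closedBall hy)
      have h2 : x - y = -(t • ((r x - x) - (r y - y))) := by
        have : x + t • (r x - x) = y + t • (r y - y) := hxy
        rw [← sub_eq_zero] at this ⊢
        rw [← this]
        module
      have h3 : ‖x - y‖ ≤ t * (K * ‖x - y‖) := by
        conv_lhs => rw [h2, norm_neg, norm_smul, Real.norm_of_nonneg ht0.le]
        rw [dist_eq_norm, dist_eq_norm] at h1
        gcongr
      by_contra hne
      have : 0 < ‖x - y‖ := norm_pos_iff.mpr (sub_ne_zero.mpr hne)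
      nlinarith
    have hmaps : ∀ x ∈ Metric.ball (0 : E) R, f t x ∈ Metric.ball (0 : E) R := by
      intro x hx
      rw [mem_ball_zero_iff] at hx ⊢
      have : f t x = (1 - t) • x + t • r x := by simp only [f]; module
      rw [this]
      calc _ ≤ ‖(1 - t) • x‖ + ‖t • r x‖ := norm_add_le _ _
        _ = (1 - t) * ‖x‖ + t * R := by
          rw [norm_smul, norm_smul, hnorm, Real.norm_of_nonneg ht0.le,
            Real.norm_of_nonneg (sub_nonneg.mpr ht1.le)]
        _ < R := by nlinarith
    have hfc : ContDiff ℝ 1 (f t) := contDiff_id.add ((hr.sub contDiff_id).const_smul t)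
    have hopen : IsOpen (f t '' Metric.ball (0 : E) R) := by
      rw [isOpen_iff_mem_nhds]
      rintro _ ⟨x, hx, rfl⟩
      have hstrict : HasStrictFDerivAt (f t) (1 + t • H x) x :=
        hfc.contDiffAt.hasStrictFDerivAt' (hf t x) one_ne_zero
      have hu : (1 + t • H x).range = ⊤ := by
        let e := LinearEquiv.ofIsUnitDet (f := ((1 + t • H x : E →L[ℝ] E) : E →ₗ[ℝ] E))
          (v := Module.finBasis ℝ E)
          (v' := Module.finBasis ℝ E) (by
          rw [LinearMap.det_toMatrix]
          exact isUnit_iff_ne_zero.mpr (hdet x (Metric.ball_subset_closedBall hx)).ne')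
        exact LinearMap.range_eq_top.mpr e.surjective
      rw [← hstrict.map_nhds_eq_of_surj hu]
      exact Filter.image_mem_map (Metric.isOpen_ball.mem_nhds hx)
    have himage : f t '' Metric.ball (0 : E) R = Metric.ball (0 : E) R := by
      refine Set.Subset.antisymm (Set.image_subset_iff.mpr hmaps) ?_
      have hcl : IsClosed (f t '' Metric.closedBall (0 : E) R) :=
        ((isCompact_closedBall _ _).image hfc.continuous).isClosed
      refine (convex_ball (0 : E) R).isPreconnected.subset_left_of_subset_union hopen
        hcl.isOpen_compl ?_ ?_ ?_
      · exact Set.disjoint_compl_right_iff_subset.mpr (Set.image_mono Metric.ball_subset_closedBall)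
      · intro y hy
        by_cases h : y ∈ f t '' Metric.closedBall (0 : E) R
        · left
          obtain ⟨x, hx, rfl⟩ := h
          refine ⟨x, ?_, rfl⟩
          rw [mem_closedBall_zero_iff] at hx
          rw [mem_ball_zero_iff] at hy ⊢
          refine lt_of_le_of_ne hx fun h => ?_
          simp [f, hid x h, h] at hy
        · exact Or.inr h
      · exact ⟨f t 0, hmaps 0 (Metric.mem_ball_self hR), 0, Metric.mem_ball_self hR, rfl⟩
    have h := MeasureTheory.integral_image_eq_integral_abs_det_fderiv_smul μ
      Metric.isOpen_ball.measurableSet (fun x _ => (hf t x).hasFDerivWithinAt) hinj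
      (fun _ => (1 : ℝ))
    rw [himage] at h
    simp only [MeasureTheory.integral_const, smul_eq_mul, mul_one,
      MeasureTheory.measureReal_restrict_apply_univ] at h
    rw [h]
    refine MeasureTheory.setIntegral_congr_fun Metric.isOpen_ball.measurableSet fun x hx => ?_
    exact (abs_of_pos (hdet x (Metric.ball_subset_closedBall hx))).symm
  obtain ⟨ε, hε, hεpos⟩ := Metric.eventually_nhds_iff.mp hpos
  let δ : ℝ := min ε (1 / (K + 1))
  have hδ : 0 < δ := by positivity
  let t : ℕ → ℝ := fun i => δ / (i + 2)
  have ht : Function.Injective t := by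
    intro i j hij
    have h1 : δ / ((i : ℝ) + 2) = δ / ((j : ℝ) + 2) := hij
    rw [div_eq_div_iff (by positivity) (by positivity)] at h1
    have := mul_left_cancel₀ hδ.ne' h1
    have : (i : ℝ) = j := by linarith
    exact_mod_cast this
  have ht0 : ∀ i, 0 < t i := fun i => by positivity
  have htδ : ∀ i, t i < δ := fun i => div_lt_self hδ (by linarith [(Nat.cast_nonneg i : (0:ℝ) ≤ i)])
  have hint : ∀ i, ∫ x in Metric.ball (0 : E) R, (1 + t i • H x).det ∂μ =
      μ.real (Metric.ball (0 : E) R) := by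
    intro i
    have hK0 : (0 : ℝ) < K + 1 := by positivity
    have h1 : t i < 1 / (K + 1) := (htδ i).trans_le (min_le_right _ _)
    rw [lt_div_iff₀ hK0] at h1
    have hKnn : (0 : ℝ) ≤ K := K.2
    refine key (t i) (ht0 i) ?_ ?_ fun x hx => hεpos ?_ x hx
    · nlinarith [ht0 i]
    · nlinarith [ht0 i]
    · rw [Real.dist_eq, sub_zero, abs_of_pos (ht0 i)]
      exact (htδ i).trans_le (min_le_left _ _)
  obtain ⟨c, hc⟩ := exists_det_one_add_eq_sum (E := E) ht
  have hc1 : ∑ i ∈ Finset.range (Module.finrank ℝ E + 1), c i = 1 := by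
    have := hc 0
    simpa [ContinuousLinearMap.det, ContinuousLinearMap.one_def] using this.symm
  have hzero : ∫ x in Metric.ball (0 : E) R, (1 + H x).det ∂μ = 0 := by simp [hdet1]
  rw [show (fun x => (1 + H x).det) = _ from funext fun x => hc (H x)] at hzero
  rw [MeasureTheory.integral_finsetSum] at hzero
  · simp_rw [MeasureTheory.integral_const_mul, hint] at hzero
    rw [← Finset.sum_mul, hc1, one_mul] at hzero
    exact (ENNReal.toReal_pos (Metric.measure_ball_pos μ (0 : E) hR).ne'
      MeasureTheory.measure_ball_lt_top.ne).ne' hzero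
  · intro i _
    have hcont : Continuous fun x => c i * (1 + t i • H x).det :=
      continuous_const.mul (hdetc.comp (continuous_const.add (hHc.const_smul (t i))))
    exact (hcont.continuousOn.integrableOn_compact (isCompact_closedBall (0 : E) R)).mono_set
      Metric.ball_subset_closedBall

/-- A continuous map on the closed unit ball fixing the unit sphere has a zero. -/
lemma exists_eq_zero_of_eqOn_sphere {E : Type*} [NormedAddCommGroup E] [InnerProductSpace ℝ E]
    [FiniteDimensional ℝ E] {F : E → E} (hF : ContinuousOn F (Metric.closedBall 0 1))
    (hid : ∀ x, ‖x‖ = 1 → F x = x) : ∃ x, ‖x‖ ≤ 1 ∧ F x = 0 := by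
  classical
  by_contra! hne
  let G : E → E := fun x => if ‖x‖ ≤ 1 then F x else x
  have hG : Continuous G := by
    refine continuous_if_le continuous_norm continuous_const ?_ continuousOn_id hid
    convert hF using 1
    ext x; simp
  have hGne : ∀ x, G x ≠ 0 := by
    intro x
    by_cases h : ‖x‖ ≤ 1
    · simpa [G, h] using hne x h
    · simp only [G, h, if_false]
      rintro rfl
      simp at h
  obtain ⟨g, hg, hgd, hgS, -⟩ := hG.exists_contDiff_approx_and_eqOn 1 hG.norm
    (fun x => norm_pos_iff.mpr (hGne x)) (S := (Metric.ball (0 : E) 2)ᶜ)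
    (U := (Metric.closedBall (0 : E) 1)ᶜ) Metric.isOpen_ball.isClosed_compl
    (Metric.isClosed_closedBall.isOpen_compl.mem_nhdsSet.mpr
      (Set.compl_subset_compl.mpr (Metric.closedBall_subset_ball (by norm_num))))
    (contDiffOn_id.congr fun x hx => by
      have : ¬ ‖x‖ ≤ 1 := by simpa using hx
      simp [G, this])
  have hgne : ∀ x, g x ≠ 0 := by
    intro x hx
    have := hgd x
    rw [hx, dist_zero_left] at this
    exact lt_irrefl _ this
  refine not_contDiff_retraction (r := fun x => (2 / ‖g x‖) • g x) two_pos
    ((contDiff_const.div (hg.norm ℝ hgne) fun x => norm_ne_zero_iff.mpr (hgne x)).smul hg)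
    (fun x => ?_) fun x hx => ?_
  · rw [norm_smul, norm_div, norm_norm, div_mul_cancel₀ _ (norm_ne_zero_iff.mpr (hgne x))]
    norm_num
  · have h1 : g x = x := by
      rw [hgS (by simp [hx])]
      simp [G, hx]
    simp [h1, hx]

lemma exists_continuousOn_apply_eq_self {E W : Type*} [NormedAddCommGroup E] [NormedSpace ℝ E]
    [ProperSpace E] [NormedAddCommGroup W] [NormedSpace ℝ W] {A : E → W →L[ℝ] W}
    (hA : Continuous A) (hidem : ∀ x w, A x (A x w) = A x w) {w₀ : W} (hw₀ : w₀ ≠ 0)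
    (hAw₀ : A 0 w₀ = w₀) :
    ∃ w : E → W, ContinuousOn w (Metric.closedBall 0 1) ∧
      ∀ x ∈ Metric.closedBall (0 : E) 1, w x ≠ 0 ∧ A x (w x) = w x := by
  have huc := (isCompact_closedBall (0 : E) 1).uniformContinuousOn_of_continuous hA.continuousOn
  obtain ⟨δ, hδ, hAδ⟩ := Metric.uniformContinuousOn_iff.mp huc 1 one_pos
  obtain ⟨N, hN⟩ := exists_nat_one_div_lt hδ
  have hN0 : (0 : ℝ) < N + 1 := by positivity
  have key : ∀ k : ℕ, k ≤ N + 1 → ∃ w : E → W, ContinuousOn w (Metric.closedBall 0 1) ∧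
      ∀ x ∈ Metric.closedBall (0 : E) 1, w x ≠ 0 ∧ A (((k : ℝ) / (N + 1)) • x) (w x) = w x := by
    intro k
    induction k with
    | zero => exact fun _ => ⟨fun _ => w₀, continuousOn_const, fun x _ => by simp [hw₀, hAw₀]⟩
    | succ k ih =>
      intro hk
      obtain ⟨w, hwc, hw⟩ := ih (by omega)
      refine ⟨fun x => A (((k + 1 : ℕ) / (N + 1 : ℝ)) • x) (w x), ?_, fun x hx => ⟨?_, hidem _ _⟩⟩
      · exact (hA.comp (continuous_const_smul _)).continuousOn.clm_apply hwc
      · intro h0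
        obtain ⟨hne, hfix⟩ := hw x hx
        have hmem : ∀ j : ℕ, j ≤ N + 1 →
            ((j : ℝ) / (N + 1)) • x ∈ Metric.closedBall (0 : E) 1 := by
          intro j hj
          rw [mem_closedBall_zero_iff] at hx ⊢
          have hj' : (j : ℝ) ≤ N + 1 := by exact_mod_cast hj
          rw [norm_smul, Real.norm_of_nonneg (by positivity)]
          exact mul_le_one₀ ((div_le_one hN0).mpr hj') (norm_nonneg _) hx
        have hd := hAδ _ (hmem k (by omega)) _ (hmem (k + 1) hk) (by
          rw [mem_closedBall_zero_iff] at hx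
          have : ((k : ℝ) / (N + 1)) • x - (((k + 1 : ℕ) : ℝ) / (N + 1)) • x =
              (-(1 / (N + 1)) : ℝ) • x := by
            rw [← sub_smul]; congr 1; push_cast; ring
          rw [dist_eq_norm, this, norm_smul, norm_neg, Real.norm_of_nonneg (by positivity)]
          exact (mul_le_of_le_one_right (by positivity) hx).trans_lt hN)
        rw [dist_eq_norm] at hd
        have h1 := (A (((k : ℝ) / (N + 1)) • x) -
          A ((((k + 1 : ℕ) : ℝ) / (N + 1)) • x)).le_opNorm (w x)
        rw [sub_apply, hfix, show A ((((k + 1 : ℕ) : ℝ) / (N + 1)) • x) (w x) = 0 from h0,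
          sub_zero] at h1
        have : 0 < ‖w x‖ := norm_pos_iff.mpr hne
        nlinarith
  obtain ⟨w, hwc, hw⟩ := key (N + 1) le_rfl
  refine ⟨w, hwc, fun x hx => ?_⟩
  have := hw x hx
  rwa [Nat.cast_succ, div_self hN0.ne', one_smul] at this

lemma exists_continuous_exp_eq {X : Type*} [TopologicalSpace X] [SimplyConnectedSpace X]
    [LocallyPathConnectedSpace X] {z : X → ℂ} (hz : Continuous z) (hz0 : ∀ x, z x ≠ 0) :
    ∃ l : X → ℂ, Continuous l ∧ ∀ x, Complex.exp (l x) = z x := by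
  have huniv : IsSimplyConnected (Set.univ : Set X) :=
    (Homeomorph.Set.univ X).toHomotopyEquiv.simplyConnectedSpace_iff.mpr inferInstance
  obtain ⟨l, hl, h⟩ := Complex.exists_continuousOn_eqOn_exp_comp huniv isOpen_univ
    hz.continuousOn (by rintro ⟨x, -, hx⟩; exact hz0 x hx)
  exact ⟨l, continuousOn_univ.mp hl, fun x => h (Set.mem_univ x)⟩

/-- The closed unit ball of `ℝ³` wrapped around the unit quaternions, collapsing its boundary to
`1`; outside the ball the map is constant. -/
def ballToSphere (x : EuclideanSpace ℝ (Fin 3)) : ℍ[ℝ] :=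
  ⟨min (2 * ‖x‖ ^ 2 - 1) 1, 2 * √(1 - ‖x‖ ^ 2) * x 0, 2 * √(1 - ‖x‖ ^ 2) * x 1,
    2 * √(1 - ‖x‖ ^ 2) * x 2⟩

lemma Quaternion.norm_eq_one_iff {q : ℍ[ℝ]} :
    ‖q‖ = 1 ↔ q.re ^ 2 + q.imI ^ 2 + q.imJ ^ 2 + q.imK ^ 2 = 1 := by
  rw [← Quaternion.normSq_def', Quaternion.normSq_eq_norm_mul_self, ← sq,
    pow_eq_one_iff_of_nonneg (norm_nonneg q) two_ne_zero]

lemma continuous_ballToSphere : Continuous ballToSphere := by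
  have h : Continuous fun x : EuclideanSpace ℝ (Fin 3) =>
      !₂[min (2 * ‖x‖ ^ 2 - 1) 1, 2 * √(1 - ‖x‖ ^ 2) * x 0, 2 * √(1 - ‖x‖ ^ 2) * x 1,
        2 * √(1 - ‖x‖ ^ 2) * x 2] := by
    refine (PiLp.continuous_toLp 2 _).comp (continuous_pi fun i => ?_)
    fin_cases i <;> simp <;> fun_prop
  exact Quaternion.linearIsometryEquivTuple.symm.continuous.comp h

lemma norm_ballToSphere (x : EuclideanSpace ℝ (Fin 3)) : ‖ballToSphere x‖ = 1 := by
  rw [Quaternion.norm_eq_one_iff]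
  have hx := EuclideanSpace.real_norm_sq_eq x
  rw [Fin.sum_univ_three] at hx
  simp only [ballToSphere]
  rcases le_total (‖x‖ ^ 2) 1 with h | h
  · rw [min_eq_left (by linarith)]
    have hs := Real.sq_sqrt (sub_nonneg.mpr h)
    linear_combination 4 * (x 0 ^ 2 + x 1 ^ 2 + x 2 ^ 2) * hs - 4 * (1 - ‖x‖ ^ 2) * hx
  · rw [min_eq_right (by linarith), Real.sqrt_eq_zero_of_nonpos (by linarith)]
    ring

lemma exists_ballToSphere_eq {q : ℍ[ℝ]} (hq : ‖q‖ = 1) :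
    ∃ x ∈ Metric.closedBall 0 1, ballToSphere x = q := by
  rw [Quaternion.norm_eq_one_iff] at hq
  by_cases h1 : q.re = 1
  · refine ⟨EuclideanSpace.single 0 1, by simp, ?_⟩
    have hI : q.imI = 0 := by nlinarith [sq_nonneg q.imI, sq_nonneg q.imJ, sq_nonneg q.imK]
    have hJ : q.imJ = 0 := by nlinarith [sq_nonneg q.imI, sq_nonneg q.imJ, sq_nonneg q.imK]
    have hK : q.imK = 0 := by nlinarith [sq_nonneg q.imI, sq_nonneg q.imJ, sq_nonneg q.imK]
    ext <;> simp [ballToSphere, h1, hI, hJ, hK]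
    norm_num
  · have hre : q.re < 1 := lt_of_le_of_ne (by
      nlinarith [sq_nonneg q.imI, sq_nonneg q.imJ, sq_nonneg q.imK]) h1
    set c := √((1 - q.re) / 2) with hc
    have hc2 : c ^ 2 = (1 - q.re) / 2 := Real.sq_sqrt (by linarith)
    have hc0 : 0 < c := Real.sqrt_pos.mpr (by linarith)
    let x : EuclideanSpace ℝ (Fin 3) := !₂[q.imI / (2 * c), q.imJ / (2 * c), q.imK / (2 * c)]
    have hx : ‖x‖ ^ 2 = (1 + q.re) / 2 := by
      rw [EuclideanSpace.real_norm_sq_eq, Fin.sum_univ_three]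
      simp only [x, Matrix.cons_val]
      field_simp
      rw [hc2]
      linear_combination hq
    have hs : √(1 - ‖x‖ ^ 2) = c := by rw [hx, hc]; congr 1; ring
    refine ⟨x, ?_, ?_⟩
    · rw [mem_closedBall_zero_iff]
      nlinarith [norm_nonneg x]
    · ext
      · simp only [ballToSphere, hx]
        rw [min_eq_left (by linarith)]
        ring
      all_goals
        simp only [ballToSphere, hs, x, Matrix.cons_val]
        field_simp

lemma eq_or_norm_eq_one_of_ballToSphere_eq {x y : EuclideanSpace ℝ (Fin 3)} (hx : ‖x‖ ≤ 1)
    (hy : ‖y‖ ≤ 1) (h : ballToSphere x = ballToSphere y) : x = y ∨ ‖x‖ = 1 ∧ ‖y‖ = 1 := by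
  have hx2 : ‖x‖ ^ 2 ≤ 1 := pow_le_one₀ (norm_nonneg x) hx
  have hy2 : ‖y‖ ^ 2 ≤ 1 := pow_le_one₀ (norm_nonneg y) hy
  have h0 := congrArg QuaternionAlgebra.re h
  have h1 := congrArg QuaternionAlgebra.imI h
  have h2 := congrArg QuaternionAlgebra.imJ h
  have h3 := congrArg QuaternionAlgebra.imK h
  simp only [ballToSphere] at h0 h1 h2 h3
  rw [min_eq_left (by linarith), min_eq_left (by linarith)] at h0
  have hn : ‖x‖ = ‖y‖ := by
    have : ‖x‖ ^ 2 = ‖y‖ ^ 2 := by linarith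
    exact (pow_left_inj₀ (norm_nonneg x) (norm_nonneg y) two_ne_zero).mp this
  rcases eq_or_lt_of_le hx with h' | h'
  · exact Or.inr ⟨h', hn ▸ h'⟩
  · left
    have hc : 2 * √(1 - ‖x‖ ^ 2) ≠ 0 := by
      have : 0 < 1 - ‖x‖ ^ 2 := by nlinarith [norm_nonneg x]
      positivity
    rw [← hn] at h1 h2 h3
    ext i
    fin_cases i
    · exact mul_left_cancel₀ hc h1
    · exact mul_left_cancel₀ hc h2
    · exact mul_left_cancel₀ hc h3

/-- A nowhere vanishing continuous function on the unit quaternions has a continuous logarithm. -/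
lemma exists_continuous_exp_eq_on_sphere {z : ℍ[ℝ] → ℂ}
    (hz : ContinuousOn z (Metric.sphere 0 1)) (hz0 : ∀ q, ‖q‖ = 1 → z q ≠ 0) :
    ∃ L : ℍ[ℝ] → ℂ, Continuous L ∧ ∀ q, ‖q‖ = 1 → Complex.exp (L q) = z q := by
  obtain ⟨l, hl, hexp⟩ := exists_continuous_exp_eq (z := fun x => z (ballToSphere x))
    (hz.comp_continuous continuous_ballToSphere fun x => by simp [norm_ballToSphere])
    fun x => hz0 _ (norm_ballToSphere x)
  have hbd : ∀ x y : EuclideanSpace ℝ (Fin 3), ‖x‖ = 1 → ‖y‖ = 1 → l x = l y := by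
    intro x y hx hy
    have hone : ∀ x : EuclideanSpace ℝ (Fin 3), ‖x‖ = 1 → ballToSphere x = 1 := by
      intro x hx
      ext <;> simp [ballToSphere, hx]
      norm_num
    have hpre : IsPreconnected (Metric.sphere (0 : EuclideanSpace ℝ (Fin 3)) 1) :=
      isPreconnected_sphere (by
        rw [← Module.finrank_eq_rank, finrank_euclideanSpace_fin]; norm_num) 0 1
    have hdisc : DiscreteTopology (Complex.exp ⁻¹' {z 1}) :=
      (Complex.isCoveringMapOn_exp (z 1) (hz0 1 norm_one)).1
    refine hpre.constant_of_mapsTo (isDiscrete_iff_discreteTopology.mpr hdisc) hl.continuousOn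
      (fun x hx => ?_) (by simpa using hx) (by simpa using hy)
    rw [mem_sphere_zero_iff_norm] at hx
    rw [Set.mem_preimage, hexp, hone x hx]
    rfl
  let K := Metric.closedBall (0 : EuclideanSpace ℝ (Fin 3)) 1
  let π : K → Metric.sphere (0 : ℍ[ℝ]) 1 := fun x => ⟨ballToSphere x, by simp [norm_ballToSphere]⟩
  have hπc : Continuous π :=
    (continuous_ballToSphere.comp continuous_subtype_val).subtype_mk _
  have hπs : Function.Surjective π := by
    rintro ⟨q, hq⟩
    obtain ⟨x, hx, h⟩ := exists_ballToSphere_eq (mem_sphere_zero_iff_norm.mp hq)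
    exact ⟨⟨x, hx⟩, Subtype.ext h⟩
  have : CompactSpace K := isCompact_iff_compactSpace.mp (isCompact_closedBall _ _)
  have hπq : Topology.IsQuotientMap π := hπc.isClosedMap.isQuotientMap hπc hπs
  let L₀ : Metric.sphere (0 : ℍ[ℝ]) 1 → ℂ := fun q => l (Function.surjInv hπs q).1
  have hL₀ : L₀ ∘ π = fun x : K => l x := by
    funext x
    have h : π (Function.surjInv hπs (π x)) = π x := Function.surjInv_eq hπs _
    rcases eq_or_norm_eq_one_of_ballToSphere_eq (mem_closedBall_zero_iff.mp (Subtype.prop _))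
      (mem_closedBall_zero_iff.mp x.2) (congrArg Subtype.val h) with h | ⟨h1, h2⟩
    · exact congrArg l h
    · exact hbd _ _ h1 h2
  have hL₀c : Continuous L₀ := by
    rw [hπq.continuous_iff, hL₀]
    exact hl.comp continuous_subtype_val
  obtain ⟨L, hL⟩ := ContinuousMap.exists_restrict_eq (Metric.isClosed_sphere)
    (⟨L₀, hL₀c⟩ : C(Metric.sphere (0 : ℍ[ℝ]) 1, ℂ))
  refine ⟨L, L.continuous, fun q hq => ?_⟩
  obtain ⟨x, hx⟩ := hπs ⟨q, mem_sphere_zero_iff_norm.mpr hq⟩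
  have h1 : L q = L₀ ⟨q, mem_sphere_zero_iff_norm.mpr hq⟩ :=
    congrArg (fun g : C(Metric.sphere (0 : ℍ[ℝ]) 1, ℂ) => g ⟨q, mem_sphere_zero_iff_norm.mpr hq⟩) hL
  have h2 : L₀ (π x) = l x := congrFun hL₀ x
  rw [h1, ← hx, h2, hexp]
  exact congrArg z (congrArg Subtype.val hx)

@[simp] lemma cq_re (z : ℂ) : (cq z).re = z.re := rfl

@[simp] lemma cq_imI (z : ℂ) : (cq z).imI = z.im := rfl

@[simp] lemma cq_imJ (z : ℂ) : (cq z).imJ = 0 := rfl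

@[simp] lemma cq_imK (z : ℂ) : (cq z).imK = 0 := rfl

lemma cq_zero : cq 0 = 0 := rfl

lemma cq_one : cq 1 = 1 := rfl

/-- The real-linear projection of the quaternions onto `ℂ`. -/
def complexPart (q : ℍ[ℝ]) : ℂ := ⟨q.re, q.imI⟩

lemma continuous_complexPart : Continuous complexPart :=
  Complex.equivRealProdCLM.symm.continuous.comp
    (Quaternion.continuous_re.prodMk Quaternion.continuous_imI)

lemma complexPart_cq (z : ℂ) : complexPart (cq z) = z := rfl

lemma complexPart_add (p q : ℍ[ℝ]) : complexPart (p + q) = complexPart p + complexPart q := rfl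

lemma complexPart_smul (r : ℝ) (q : ℍ[ℝ]) : complexPart (r • q) = r * complexPart q := by
  apply Complex.ext <;> simp [complexPart]

lemma complexPart_cq_mul (z : ℂ) (q : ℍ[ℝ]) : complexPart (cq z * q) = z * complexPart q := by
  apply Complex.ext <;> simp [complexPart]

lemma cq_add (z w : ℂ) : cq (z + w) = cq z + cq w := Quaternion.coeComplex_add z w

lemma cq_mul (z w : ℂ) : cq (z * w) = cq z * cq w := Quaternion.coeComplex_mul z w

lemma cq_ofReal (r : ℝ) : cq r = r := Quaternion.coeComplex_coe r

lemma star_cq (z : ℂ) : star (cq z) = cq (star z) := by ext <;> simp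

lemma cq_ofReal_mul (r : ℝ) (z : ℂ) : cq (r * z) = r • cq z := by
  rw [cq_mul, cq_ofReal, Quaternion.coe_mul_eq_smul]

lemma continuous_cq : Continuous cq :=
  Quaternion.ofComplex.toLinearMap.continuous_of_finiteDimensional

/-- The squared Euclidean norm of a vector of `ℍ³`. -/
def sqNorm (v : Fin 3 → ℍ[ℝ]) : ℝ := ∑ i, Quaternion.normSq (v i)

/-- The standard quaternionic Hermitian form on `ℍ³`. -/
def hermitian (v w : Fin 3 → ℍ[ℝ]) : ℍ[ℝ] := ∑ i, star (v i) * w i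

lemma sqNorm_ne_zero {v : Fin 3 → ℍ[ℝ]} (hv : v ≠ 0) : sqNorm v ≠ 0 := by
  contrapose! hv
  rw [sqNorm, Finset.sum_eq_zero_iff_of_nonneg fun i _ => Quaternion.normSq_nonneg] at hv
  funext i
  exact Quaternion.normSq_eq_zero.mp (hv i (Finset.mem_univ i))

lemma continuous_sqNorm : Continuous sqNorm :=
  continuous_finsetSum _ fun i _ => Quaternion.continuous_normSq.comp (continuous_apply i)

lemma hermitian_mul_right (v : Fin 3 → ℍ[ℝ]) (a : ℍ[ℝ]) :
    hermitian v (fun i => v i * a) = sqNorm v • a := by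
  simp only [hermitian, sqNorm, ← mul_assoc, Quaternion.star_mul_self, 
    Quaternion.coe_mul_eq_smul, Finset.sum_smul]

/-- The orthogonal projection of `ℍ³` onto the complex line spanned by `v`. -/
def lineProj (v : Fin 3 → ℍ[ℝ]) : (Fin 3 → ℍ[ℝ]) →L[ℝ] (Fin 3 → ℍ[ℝ]) :=
  LinearMap.toContinuousLinearMap
    { toFun := fun w i => (sqNorm v)⁻¹ • (v i * cq (complexPart (hermitian v w)))
      map_add' := fun w w' => by
        funext i
        have : hermitian v (w + w') = hermitian v w + hermitian v w' := by
          simp [hermitian, mul_add, Finset.sum_add_distrib]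
        simp only [this, complexPart_add, cq_add, mul_add, smul_add, Pi.add_apply]
      map_smul' := fun r w => by
        funext i
        have : hermitian v (r • w) = r • hermitian v w := by
          simp [hermitian, Finset.smul_sum]
        simp only [this, complexPart_smul, cq_ofReal_mul, mul_smul_comm, RingHom.id_apply,
          Pi.smul_apply, smul_comm r] }

lemma lineProj_apply (v w : Fin 3 → ℍ[ℝ]) :
    lineProj v w = fun i => (sqNorm v)⁻¹ • (v i * cq (complexPart (hermitian v w))) := rfl

lemma lineProj_mul_cq {v : Fin 3 → ℍ[ℝ]} (hv : v ≠ 0) (c : ℂ) :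
    lineProj v (fun i => v i * cq c) = fun i => v i * cq c := by
  rw [lineProj_apply, hermitian_mul_right, complexPart_smul, complexPart_cq, cq_ofReal_mul]
  funext i
  rw [mul_smul_comm, smul_smul, inv_mul_cancel₀ (sqNorm_ne_zero hv), one_smul]

lemma lineProj_eq_mul_cq (v w : Fin 3 → ℍ[ℝ]) :
    ∃ c : ℂ, lineProj v w = fun i => v i * cq c :=
  ⟨((sqNorm v)⁻¹ : ℝ) * complexPart (hermitian v w), by
    rw [lineProj_apply, cq_ofReal_mul]; funext i; rw [mul_smul_comm]⟩

lemma lineProj_lineProj {v : Fin 3 → ℍ[ℝ]} (hv : v ≠ 0) (w : Fin 3 → ℍ[ℝ]) :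
    lineProj v (lineProj v w) = lineProj v w := by
  obtain ⟨c, hc⟩ := lineProj_eq_mul_cq v w
  rw [hc, lineProj_mul_cq hv]

lemma lineProj_mul_cq_left (v : Fin 3 → ℍ[ℝ]) {c : ℂ} (hc : c ≠ 0) :
    lineProj (fun i => v i * cq c) = lineProj v := by
  have hn : Complex.normSq c ≠ 0 := fun h => hc (Complex.normSq_eq_zero.mp h)
  have h1 : sqNorm (fun i => v i * cq c) = Complex.normSq c * sqNorm v := by
    have : Quaternion.normSq (cq c) = Complex.normSq c := by
      rw [Quaternion.normSq_def', Complex.normSq_apply]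
      simp [sq]
    simp [sqNorm, this, Finset.mul_sum, mul_comm]
  ext1 w
  have h2 : hermitian (fun i => v i * cq c) w = cq (star c) * hermitian v w := by
    simp only [hermitian, star_mul, star_cq, mul_assoc, Finset.mul_sum]
  rw [lineProj_apply, lineProj_apply, h1, h2, complexPart_cq_mul]
  funext i
  have h3 : c * (star c * complexPart (hermitian v w)) =
      (Complex.normSq c : ℝ) * complexPart (hermitian v w) := by
    rw [← mul_assoc]
    congr 1
    exact Complex.mul_conj c
  rw [mul_assoc, ← cq_mul, h3, cq_ofReal_mul, mul_smul_comm, smul_smul, mul_inv]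
  congr 1
  field_simp

lemma continuous_lineProj : Continuous fun v : V3x => lineProj v.1 := by
  refine continuous_clm_apply.mpr fun w => continuous_pi fun i => ?_
  have hv : ∀ j, Continuous fun v : V3x => v.1 j := fun j =>
    (continuous_apply j).comp continuous_subtype_val
  have hh : Continuous fun v : V3x => hermitian v.1 w :=
    continuous_finsetSum _ fun j _ => (hv j).star.mul continuous_const
  exact ((continuous_sqNorm.comp continuous_subtype_val).inv₀ fun v => sqNorm_ne_zero v.2).smul
    ((hv i).mul (continuous_cq.comp (continuous_complexPart.comp hh)))

/-- The orthogonal projection onto a point of `ℂP⁵`, regarded as a complex line in `ℍ³`. -/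
def CP5.proj : CP5 → (Fin 3 → ℍ[ℝ]) →L[ℝ] (Fin 3 → ℍ[ℝ]) :=
  Quot.lift (fun v => lineProj v.1) fun v w ⟨c, hc, hw⟩ => by
    rw [hw, lineProj_mul_cq_left v.1 hc]

lemma CP5.continuous_proj : Continuous CP5.proj := continuous_quot_lift _ continuous_lineProj

lemma hrel_equivalence : Equivalence hrel where
  refl v := ⟨1, one_ne_zero, by simp⟩
  symm := by
    rintro v w ⟨a, ha, hw⟩
    exact ⟨a⁻¹, inv_ne_zero ha, by funext i; rw [hw]; simp [ha]⟩
  trans := by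
    rintro u v w ⟨a, ha, hv⟩ ⟨b, hb, hw⟩
    exact ⟨a * b, mul_ne_zero ha hb, by rw [hw, hv]; funext i; exact mul_assoc _ _ _⟩

lemma hrel_of_mk_eq {v w : V3x} (h : Quot.mk hrel v = Quot.mk hrel w) : hrel v w :=
  hrel_equivalence.eqvGen_iff.mp (Quot.eqvGen_exact h)

/-- The vector `(q, √(1 - |q|²), 0)`. As `q` runs over the unit ball, it parametrizes the
quaternionic projective line `ℍP¹ ⊆ ℍP²`, the unit sphere being collapsed to a point. -/
def diskVector (q : ℍ[ℝ]) : Fin 3 → ℍ[ℝ] := ![q, ((√(1 - ‖q‖ ^ 2) : ℝ) : ℍ[ℝ]), 0]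

lemma continuous_diskVector : Continuous diskVector := by
  refine continuous_pi fun i => ?_
  fin_cases i
  · exact continuous_id
  · exact Quaternion.continuous_coe.comp
      (Real.continuous_sqrt.comp (continuous_const.sub (continuous_norm.pow 2)))
  · exact continuous_const

lemma diskVector_ne_zero (q : ℍ[ℝ]) : diskVector q ≠ 0 := by
  intro h
  have h0 : q = 0 := congrFun h 0
  have h1 : ((√(1 - ‖q‖ ^ 2) : ℝ) : ℍ[ℝ]) = 0 := congrFun h 1
  rw [h0] at h1
  norm_num at h1

lemma diskVector_of_norm_eq_one {q : ℍ[ℝ]} (hq : ‖q‖ = 1) : diskVector q = ![q, 0, 0] := by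
  simp [diskVector, hq]

/-- The twistor map admits no continuous global section. -/
theorem twistor_no_section :
    ¬ ∃ s : HP2 → CP5, Continuous s ∧ ∀ b : HP2, twistor (s b) = b := by
  rintro ⟨s, hs, hsec⟩
  let p : ℍ[ℝ] → V3x := fun q => ⟨diskVector q, diskVector_ne_zero q⟩
  let f : ℍ[ℝ] → CP5 := fun q => s (Quot.mk hrel (p q))
  have hf : Continuous f :=
    hs.comp (continuous_quot_mk.comp (continuous_diskVector.subtype_mk diskVector_ne_zero))
  have hrep : ∀ q, ∃ v : V3x, f q = Quot.mk crel v ∧ hrel (p q) v := by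
    intro q
    obtain ⟨v, hv⟩ := Quot.exists_rep (f q)
    refine ⟨v, hv.symm, hrel_of_mk_eq ?_⟩
    have h := hsec (Quot.mk hrel (p q))
    change twistor (f q) = _ at h
    rw [← hv] at h
    exact h.symm
  -- a continuous choice of nonzero vectors in the complex lines `f q`
  obtain ⟨v₀, hv₀, -⟩ := hrep 0
  obtain ⟨w, hwc, hw⟩ := exists_continuousOn_apply_eq_self (A := fun q => (f q).proj)
    (CP5.continuous_proj.comp hf)
    (fun q u => by
      obtain ⟨v, hv, -⟩ := hrep q
      simp only [hv]
      exact lineProj_lineProj v.2 u) v₀.2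
    (by
      rw [hv₀]
      change lineProj v₀.1 v₀.1 = v₀.1
      simpa only [cq_one, mul_one] using lineProj_mul_cq v₀.2 1)
  have hwline : ∀ q ∈ Metric.closedBall (0 : ℍ[ℝ]) 1, ∀ v : V3x, f q = Quot.mk crel v →
      ∃ c : ℂ, c ≠ 0 ∧ w q = fun i => v.1 i * cq c := by
    intro q hq v hv
    obtain ⟨hne, hfix⟩ := hw q hq
    simp only [hv] at hfix
    obtain ⟨c, hc⟩ := lineProj_eq_mul_cq v.1 (w q)
    have hwq : w q = fun i => v.1 i * cq c := hfix.symm.trans hc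
    refine ⟨c, ?_, hwq⟩
    rintro rfl
    apply hne
    rw [hwq]
    funext i
    simp [cq_zero]
  let lam : ℍ[ℝ] → ℍ[ℝ] := fun q => (sqNorm (diskVector q))⁻¹ • hermitian (diskVector q) (w q)
  have hlamc : ContinuousOn lam (Metric.closedBall 0 1) := by
    refine ContinuousOn.fun_smul ?_ ?_
    · exact ((continuous_sqNorm.comp continuous_diskVector).inv₀
        fun q => sqNorm_ne_zero (diskVector_ne_zero q)).continuousOn
    · refine continuousOn_finsetSum _ fun i _ => ContinuousOn.fun_mul ?_ ?_
      · exact ((continuous_apply i).comp continuous_diskVector).star.continuousOn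
      · exact (continuous_apply i).comp_continuousOn hwc
  have hlam : ∀ q ∈ Metric.closedBall (0 : ℍ[ℝ]) 1,
      lam q ≠ 0 ∧ w q = fun i => diskVector q i * lam q := by
    intro q hq
    obtain ⟨v, hv, a, ha, hva⟩ := hrep q
    obtain ⟨c, hc, hwq⟩ := hwline q hq v hv
    have h1 : w q = fun i => diskVector q i * (a * cq c) := by
      rw [hwq, hva]; funext i; rw [mul_assoc]
    have h2 : lam q = a * cq c := by
      simp only [lam]
      rw [h1, hermitian_mul_right, smul_smul,
        inv_mul_cancel₀ (sqNorm_ne_zero (diskVector_ne_zero q)), one_smul]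
    rw [h2]
    exact ⟨mul_ne_zero ha (cq_ne_zero hc), h1⟩
  -- on the unit sphere all the lines `f q` agree
  obtain ⟨v₁, hv₁, a, ha, hva⟩ := hrep 1
  have hbd : ∀ q, ‖q‖ = 1 → f q = Quot.mk crel v₁ := by
    intro q hq
    have hq0 : q ≠ 0 := by rintro rfl; simp at hq
    have : Quot.mk hrel (p 1) = Quot.mk hrel (p q) := Quot.sound ⟨q, hq0, by
      change diskVector q = fun i => diskVector 1 i * q
      rw [diskVector_of_norm_eq_one hq, diskVector_of_norm_eq_one norm_one]
      funext i
      fin_cases i <;> simp⟩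
    rw [← hv₁]
    exact congrArg s this.symm
  have hv₁0 : v₁.1 0 = a := by
    rw [hva]
    change diskVector 1 0 * a = a
    rw [diskVector_of_norm_eq_one norm_one]
    simp
  let z : ℍ[ℝ] → ℂ := fun q => complexPart (a⁻¹ * (q * lam q))
  have hz : ∀ q, ‖q‖ = 1 → z q ≠ 0 ∧ q * lam q = a * cq (z q) := by
    intro q hq
    have hqm : q ∈ Metric.closedBall (0 : ℍ[ℝ]) 1 := by simp [hq]
    obtain ⟨c, hc, hwq⟩ := hwline q hqm v₁ (hbd q hq)
    have h1 : q * lam q = a * cq c := by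
      have h := congrFun ((hlam q hqm).2.symm.trans hwq) 0
      rwa [hv₁0, diskVector_of_norm_eq_one hq] at h
    have h2 : z q = c := by
      simp only [z]
      rw [h1, ← mul_assoc, inv_mul_cancel₀ ha, one_mul, complexPart_cq]
    rw [h2]
    exact ⟨hc, h1⟩
  obtain ⟨L, hL, hexp⟩ := exists_continuous_exp_eq_on_sphere (z := z)
    (continuous_complexPart.comp_continuousOn (continuousOn_const.mul (continuousOn_id.mul
      (hlamc.mono Metric.sphere_subset_closedBall)))) fun q hq => (hz q hq).1
  obtain ⟨q, hq, h0⟩ := exists_eq_zero_of_eqOn_sphere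
    (F := fun q => a * cq (Complex.exp (L q)) * (lam q)⁻¹)
    ((continuous_const.mul (continuous_cq.comp (Complex.continuous_exp.comp hL))).continuousOn.mul
      (hlamc.inv₀ fun q hq => (hlam q hq).1)) (fun q hq => by
        have hqm : q ∈ Metric.closedBall (0 : ℍ[ℝ]) 1 := by simp [hq]
        simp only [hexp q hq]
        rw [← (hz q hq).2, mul_inv_cancel_right₀ (hlam q hqm).1])
  exact mul_ne_zero (mul_ne_zero ha (cq_ne_zero (Complex.exp_ne_zero _)))
    (inv_ne_zero (hlam q (by simpa using hq)).1) h0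

end
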